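/- Let k ≥ 1, let u ∈ F_n^k be a unitary, let λ_u : A → A be a unital *-homomorphism with λ_u(Sᵢ) = uSᵢ for all i, and assume A is generated by S₁,…,Sₙ. Then the following are equivalent: (i) λ_u ∘ λ_u = id_A; (ii) λ_u(u)u = 1; (iii) u_k u u_k* = u*. -/

import Mathlib

noncomputable section CuntzSetup

/-- The word `S_μ = S_{μ₁} ⋯ S_{μ_k}` associated to a multi-index `μ ∈ {1,…,n}^k`. -/
def cuntzWord {A : Type*} [Monoid A] {n k : ℕ} (S : Fin n → A) (μ : Fin k → Fin n) : A :=
  (List.ofFn fun i => S (μ i)).prod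

/-- The canonical shift `φ(x) = ∑ᵢ Sᵢ x Sᵢ*`. -/
def cuntzPhi {A : Type*} [Ring A] [StarRing A] {n : ℕ} (S : Fin n → A) (x : A) : A :=
  ∑ i, S i * x * star (S i)

/-- `u_k = u φ(u) φ²(u) ⋯ φ^{k-1}(u)`. -/
def cuntzUk {A : Type*} [Ring A] [StarRing A] {n : ℕ} (S : Fin n → A) (u : A) (k : ℕ) : A :=
  ((List.range k).map fun j => (cuntzPhi S)^[j] u).prod

/-- `F_n^k`, the linear span of `{S_μ S_ν* : |μ| = |ν| = k}`. -/
def cuntzF {A : Type*} [Ring A] [StarRing A] [Algebra ℂ A] {n : ℕ} (S : Fin n → A) (k : ℕ) :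
    Submodule ℂ A :=
  Submodule.span ℂ {x | ∃ μ ν : Fin k → Fin n, x = cuntzWord S μ * star (cuntzWord S ν)}

end CuntzSetup

theorem cuntz_star_mul_of_ne {A : Type*} [NormedRing A] [StarRing A] [CStarRing A]
    [CompleteSpace A] [NormedAlgebra ℂ A] [StarModule ℂ A] {n : ℕ} {S : Fin n → A}
    (hiso : ∀ i, star (S i) * S i = 1) (hcuntz : ∑ i, S i * star (S i) = 1)
    {i j : Fin n} (hij : i ≠ j) : star (S i) * S j = 0 := by
  let _ : CStarAlgebra A := { }
  let _ : PartialOrder A := CStarAlgebra.spectralOrder A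
  let _ : StarOrderedRing A := CStarAlgebra.spectralOrderedRing A
  have hsum : ∑ l, star (star (S l) * S j) * (star (S l) * S j) = 1 := by
    calc ∑ l, star (star (S l) * S j) * (star (S l) * S j)
        = star (S j) * (∑ l, S l * star (S l)) * S j := by
          simp only [Finset.mul_sum, Finset.sum_mul, star_mul, star_star, mul_assoc]
      _ = 1 := by rw [hcuntz, mul_one, hiso]
  have hzero : ∑ l ∈ Finset.univ.erase j, star (star (S l) * S j) * (star (S l) * S j) = 0 := by
    rw [← Finset.add_sum_erase _ _ (Finset.mem_univ j)] at hsum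
    rw [hiso, star_one, one_mul] at hsum
    exact add_eq_left.1 hsum
  have h := (Finset.sum_eq_zero_iff_of_nonneg fun l _ => star_mul_self_nonneg _).1 hzero i
    (Finset.mem_erase.2 ⟨hij, Finset.mem_univ i⟩)
  exact CStarRing.star_mul_self_eq_zero_iff _ |>.1 h

section CuntzShift

variable {A : Type*} [Ring A] [StarRing A] {n : ℕ} {S : Fin n → A}

theorem eq_one_of_mul_cuntz_eq (hcuntz : ∑ i, S i * star (S i) = 1) {x : A}
    (hx : ∀ i, x * S i = S i) : x = 1 := by
  calc x = x * ∑ i, S i * star (S i) := by rw [hcuntz, mul_one]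
    _ = ∑ i, x * S i * star (S i) := by simp only [Finset.mul_sum, mul_assoc]
    _ = 1 := by simp only [hx, hcuntz]

theorem cuntzPhi_mul_cuntz (hiso : ∀ i, star (S i) * S i = 1)
    (horth : ∀ i j, i ≠ j → star (S i) * S j = 0) (x : A) (i : Fin n) :
    cuntzPhi S x * S i = S i * x := by
  rw [cuntzPhi, Finset.sum_mul, Finset.sum_eq_single i]
  · rw [mul_assoc, hiso, mul_one]
  · intro j _ hj
    rw [mul_assoc, horth j i hj, mul_zero]
  · simp

theorem cuntzPhi_one (hcuntz : ∑ i, S i * star (S i) = 1) : cuntzPhi S 1 = 1 := by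
  simpa [cuntzPhi] using hcuntz

theorem cuntzPhi_mul (hiso : ∀ i, star (S i) * S i = 1)
    (horth : ∀ i j, i ≠ j → star (S i) * S j = 0) (x y : A) :
    cuntzPhi S (x * y) = cuntzPhi S x * cuntzPhi S y := by
  rw [cuntzPhi.eq_1 S y, Finset.mul_sum, cuntzPhi]
  refine Finset.sum_congr rfl fun i _ => ?_
  simp only [← mul_assoc, cuntzPhi_mul_cuntz hiso horth]

theorem cuntzUk_succ (hiso : ∀ i, star (S i) * S i = 1)
    (horth : ∀ i j, i ≠ j → star (S i) * S j = 0) (hcuntz : ∑ i, S i * star (S i) = 1)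
    (u : A) (k : ℕ) : cuntzUk S u (k + 1) = u * cuntzPhi S (cuntzUk S u k) := by
  let φ : A →* A :=
    { toFun := cuntzPhi S
      map_one' := cuntzPhi_one hcuntz
      map_mul' := cuntzPhi_mul hiso horth }
  have h : φ (cuntzUk S u k) = _ := map_list_prod φ _
  change cuntzPhi S (cuntzUk S u k) = _ at h
  rw [h, cuntzUk, List.range_succ_eq_map, List.map_cons, List.prod_cons, List.map_map,
    List.map_map]
  congr 3
  funext j
  exact Function.iterate_succ_apply' (cuntzPhi S) j u

theorem map_cuntzWord [Algebra ℂ A] (hiso : ∀ i, star (S i) * S i = 1)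
    (horth : ∀ i j, i ≠ j → star (S i) * S j = 0) (hcuntz : ∑ i, S i * star (S i) = 1)
    {u : A} {lu : A →⋆ₐ[ℂ] A} (hlu : ∀ i, lu (S i) = u * S i) (k : ℕ) (μ : Fin k → Fin n) :
    lu (cuntzWord S μ) = cuntzUk S u k * cuntzWord S μ := by
  induction k with
  | zero => simp [cuntzWord, cuntzUk]
  | succ k ih =>
    have hw : cuntzWord S μ = S (μ 0) * cuntzWord S fun i => μ i.succ := by
      simp [cuntzWord, List.ofFn_succ]
    rw [hw, map_mul, ih, hlu, cuntzUk_succ hiso horth hcuntz]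
    simp only [mul_assoc]
    rw [← mul_assoc (cuntzPhi S _), cuntzPhi_mul_cuntz hiso horth, mul_assoc]

theorem map_eq_conj_of_mem_cuntzF [Algebra ℂ A] (hiso : ∀ i, star (S i) * S i = 1)
    (horth : ∀ i j, i ≠ j → star (S i) * S j = 0) (hcuntz : ∑ i, S i * star (S i) = 1)
    {u : A} {lu : A →⋆ₐ[ℂ] A} (hlu : ∀ i, lu (S i) = u * S i) {k : ℕ} {a : A}
    (ha : a ∈ cuntzF S k) : lu a = cuntzUk S u k * a * star (cuntzUk S u k) := by
  induction ha using Submodule.span_induction with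
  | mem x hx =>
    obtain ⟨μ, ν, rfl⟩ := hx
    rw [map_mul, map_star, map_cuntzWord hiso horth hcuntz hlu,
      map_cuntzWord hiso horth hcuntz hlu, star_mul]
    simp only [mul_assoc]
  | zero => simp
  | add x y _ _ hx hy => rw [map_add, hx, hy, mul_add, add_mul]
  | smul c x _ hx => rw [map_smul, hx, mul_smul_comm, smul_mul_assoc]

end CuntzShift

open scoped CStarAlgebra in
theorem StarAlgHom.eq_of_eqOn_of_topologicalClosure_adjoin_eq_top {A : Type*} [NormedRing A]
    [StarRing A] [CStarRing A] [CompleteSpace A] [NormedAlgebra ℂ A] [StarModule ℂ A]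
    {s : Set A} (hs : (StarAlgebra.adjoin ℂ s).topologicalClosure = ⊤)
    {f g : A →⋆ₐ[ℂ] A} (hfg : Set.EqOn f g s) : f = g := by
  let _ : CStarAlgebra A := { }
  have hf : Continuous f := map_continuous f
  have hg : Continuous g := map_continuous g
  have hle : StarAlgebra.adjoin ℂ s ≤ StarAlgHom.equalizer f g :=
    StarAlgHom.adjoin_le_equalizer f g hfg
  have hcl : (StarAlgebra.adjoin ℂ s).topologicalClosure ≤ StarAlgHom.equalizer f g :=
    StarSubalgebra.topologicalClosure_minimal hle (isClosed_eq hf hg)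
  ext a
  exact hcl (hs ▸ StarSubalgebra.mem_top)

/-- for a unitary `u ∈ F_n^k` the following are equivalent:
(i) `λ_u² = id`; (ii) `λ_u(u)u = 1`; (iii) `u_k u u_k* = u*`. -/
theorem stmt10 {A : Type*} [NormedRing A] [StarRing A] [CStarRing A]
    [CompleteSpace A] [NormedAlgebra ℂ A] [StarModule ℂ A]
    {n : ℕ} (hn : 2 ≤ n) (S : Fin n → A)
    (hiso : ∀ i, star (S i) * S i = 1)
    (hcuntz : ∑ i, S i * star (S i) = 1)
    (hgen : (StarAlgebra.adjoin ℂ (Set.range S)).topologicalClosure = ⊤)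
    (k : ℕ) (hk : 1 ≤ k)
    (u : A) (huF : u ∈ cuntzF S k) (hu : u ∈ unitary A)
    (lu : A →⋆ₐ[ℂ] A) (hlu : ∀ i, lu (S i) = u * S i) :
    ((∀ a : A, lu (lu a) = a) ↔ lu u * u = 1) ∧
      ((lu u * u = 1) ↔ cuntzUk S u k * u * star (cuntzUk S u k) = star u) := by
  have horth : ∀ i j, i ≠ j → star (S i) * S j = 0 := fun i j =>
    cuntz_star_mul_of_ne hiso hcuntz
  have hsq : ∀ i, lu (lu (S i)) = lu u * u * S i := fun i => by
    rw [hlu, map_mul, hlu, mul_assoc]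
  refine ⟨⟨fun h => eq_one_of_mul_cuntz_eq hcuntz fun i => by rw [← hsq, h], fun h a => ?_⟩, ?_⟩
  · have hid : lu.comp lu = StarAlgHom.id ℂ A := by
      refine StarAlgHom.eq_of_eqOn_of_topologicalClosure_adjoin_eq_top hgen ?_
      rintro _ ⟨i, rfl⟩
      simp [hsq, h]
    exact DFunLike.congr_fun hid a
  · rw [← map_eq_conj_of_mem_cuntzF hiso horth hcuntz hlu huF]
    exact ⟨fun h => left_inv_eq_right_inv h (Unitary.mul_star_self_of_mem hu),
      fun h => by rw [h, Unitary.star_mul_self_of_mem hu]⟩
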